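/- Let G=(V,A) and G'=(V,A') be two (≤6)-hemimorphic digraphs, let D be an arc-connected component of G, and let I0⊂V with |I0|=C_dual(G), G[I0] not self-dual, and G'[I0]≅G[I0]. Then: (1) every difference class C∈D_{G,G'} is an interval of both G and G'; (2) if D is not an interval of G, then the difference relation 𝔇_{G[D],G'[D]} has at least two equivalence classes; (3) if C_dual(G[D])=3, then 𝔇_{G[D],G'[D]} has at least two equivalence classes. -/

import Mathlib

universe u v

/-- A digraph: an irreflexive binary relation on a vertex type. -/
structure Dgraph (V : Type u) where
  Arc : V → V → Prop
  irrefl : ∀ x, ¬ Arc x x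

namespace Dgraph

variable {V : Type u} {W : Type v}

/-- The dual digraph. -/
def dual (G : Dgraph V) : Dgraph V :=
  ⟨fun x y => G.Arc y x, fun x h => G.irrefl x h⟩

/-- Subdigraph induced by a set of vertices. -/
def ind (G : Dgraph V) (X : Set V) : Dgraph X :=
  ⟨fun x y => G.Arc x y, fun x h => G.irrefl x h⟩

/-- Isomorphism of digraphs. -/
def Iso (G : Dgraph V) (G' : Dgraph W) : Prop :=
  ∃ e : V ≃ W, ∀ x y, G.Arc x y ↔ G'.Arc (e x) (e y)

/-- `G` and `G'` are hemimorphic: `G'` is isomorphic to `G` or to its dual. -/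
def Hemi (G : Dgraph V) (G' : Dgraph W) : Prop :=
  Iso G G' ∨ Iso G.dual G'

/-- Self-dual digraph. -/
def SelfDual (G : Dgraph V) : Prop := Iso G G.dual

/-- `{x,y}` is a directed pair. -/
def Dir (G : Dgraph V) (x y : V) : Prop :=
  (G.Arc x y ∧ ¬ G.Arc y x) ∨ (G.Arc y x ∧ ¬ G.Arc x y)

/-- `{x,y}` is a neutral pair (full or void). -/
def Neutral (G : Dgraph V) (x y : V) : Prop :=
  x ≠ y ∧ ¬ G.Dir x y

/-- Interval of a digraph. -/
def IsInterval (G : Dgraph V) (I : Set V) : Prop :=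
  ∀ x ∉ I,
    (∀ y ∈ I, G.Arc x y ∧ ¬ G.Arc y x) ∨ (∀ y ∈ I, G.Arc y x ∧ ¬ G.Arc x y) ∨
    (∀ y ∈ I, G.Arc x y ∧ G.Arc y x) ∨ (∀ y ∈ I, ¬ G.Arc x y ∧ ¬ G.Arc y x)

/-- The arc-connectivity equivalence relation. -/
def ACRel (G : Dgraph V) : V → V → Prop := Relation.ReflTransGen G.Dir

/-- Arc-connected components. -/
def IsACComponent (G : Dgraph V) (D : Set V) : Prop :=
  ∃ x, D = {y | G.ACRel x y}

/-- Arc-connected digraph (at most one arc-connected component). -/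
def ArcConnected (G : Dgraph V) : Prop := ∀ x y, G.ACRel x y

/-- Tournament. -/
def IsTournament (G : Dgraph V) : Prop := ∀ x y, x ≠ y → G.Dir x y

/-- Chain (transitive tournament). -/
def IsChainD (G : Dgraph V) : Prop :=
  G.IsTournament ∧ ∀ x y z, G.Arc x y → G.Arc y z → G.Arc x z

/-- Dgraph from a relation, with forced irreflexivity. -/
def ofRel (r : V → V → Prop) : Dgraph V := ⟨fun x y => x ≠ y ∧ r x y, fun x h => h.1 rfl⟩

/-- The model flag. -/
def flagD : Dgraph (Fin 3) :=
  ofRel (fun x y => (x = 0 ∧ y = 1) ∨ (x = 1 ∧ y = 2) ∨ (x = 2 ∧ y = 1))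

/-- First model peak. -/
def peakD1 : Dgraph (Fin 3) :=
  ofRel (fun x y => (x = 0 ∧ y = 1) ∨ (x = 0 ∧ y = 2) ∨ (x = 1 ∧ y = 2) ∨ (x = 2 ∧ y = 1))

/-- Second model peak. -/
def peakD2 : Dgraph (Fin 3) :=
  ofRel (fun x y => (x = 0 ∧ y = 1) ∨ (x = 0 ∧ y = 2))

/-- The model diamond. -/
def diamondD : Dgraph (Fin 4) :=
  ofRel (fun x y => (x = 0 ∧ y = 1) ∨ (x = 0 ∧ y = 2) ∨ (x = 0 ∧ y = 3) ∨
    (x = 1 ∧ y = 2) ∨ (x = 2 ∧ y = 3) ∨ (x = 3 ∧ y = 1))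

/-- A flag is a digraph hemimorphic to the model flag. -/
def IsFlag (G : Dgraph V) : Prop := Hemi G flagD

/-- A peak is a digraph hemimorphic to one of the two model peaks. -/
def IsPeak (G : Dgraph V) : Prop := Hemi G peakD1 ∨ Hemi G peakD2

/-- A diamond is a digraph hemimorphic to the model diamond. -/
def IsDiamond (G : Dgraph V) : Prop := Hemi G diamondD

/-- Prechain: embeds no peak, no diamond, no two adjacent neutral pairs. -/
def IsPrechain (G : Dgraph V) : Prop :=
  (∀ X : Set V, ¬ IsPeak (G.ind X)) ∧ (∀ X : Set V, ¬ IsDiamond (G.ind X)) ∧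
  ¬ ∃ x y z : V, y ≠ z ∧ G.Neutral x y ∧ G.Neutral x z

/-- Proper prechain: a prechain which is not a chain. -/
def ProperPrechain (G : Dgraph V) : Prop := G.IsPrechain ∧ ¬ G.IsChainD

/-- Diamond-free tournament. -/
def DiamondFreeTournament (G : Dgraph V) : Prop :=
  G.IsTournament ∧ ∀ X : Set V, ¬ IsDiamond (G.ind X)

/-- Non-tournament prechain. -/
def NonTournamentPrechain (G : Dgraph V) : Prop := G.IsPrechain ∧ ¬ G.IsTournament

/-- Model finite consecutivity on `n` vertices (`full` decides whether the
non-consecutive pairs are all full or all void). -/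
def consecFin (n : ℕ) (full : Bool) : Dgraph (Fin n) :=
  ofRel (fun i j => i.1 + 1 = j.1 ∨ (full = true ∧ (i.1 + 1 < j.1 ∨ j.1 + 1 < i.1)))

/-- Model consecutivity of type ω. -/
def consecNat (full : Bool) : Dgraph ℕ :=
  ofRel (fun i j => i + 1 = j ∨ (full = true ∧ (i + 1 < j ∨ j + 1 < i)))

/-- Model consecutivity of type ω*+ω. -/
def consecInt (full : Bool) : Dgraph ℤ :=
  ofRel (fun i j => i + 1 = j ∨ (full = true ∧ (i + 1 < j ∨ j + 1 < i)))

/-- One-end infinite consecutivity (obtained from ω or ω*). -/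
def OneEndInfiniteConsecutivity (G : Dgraph V) : Prop :=
  ∃ full, Iso G (consecNat full) ∨ Iso G (consecNat full).dual

/-- Consecutivity. -/
def IsConsecutivity (G : Dgraph V) : Prop :=
  (∃ n, 3 ≤ n ∧ ∃ full, Iso G (consecFin n full)) ∨
  G.OneEndInfiniteConsecutivity ∨ (∃ full, Iso G (consecInt full))

/-- Model cycle on `n ≥ 3` vertices obtained from the finite consecutivity by
replacing the neutral pair `{0, n-1}` by the arc `(n-1, 0)`. -/
def cycleD (n : ℕ) (full : Bool) : Dgraph (Fin n) :=
  ofRel (fun i j => i.1 + 1 = j.1 ∨ (i.1 = n - 1 ∧ j.1 = 0) ∨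
    (full = true ∧ (i.1 + 1 < j.1 ∨ j.1 + 1 < i.1) ∧
      ¬ (i.1 = 0 ∧ j.1 = n - 1) ∧ ¬ (i.1 = n - 1 ∧ j.1 = 0)))

/-- Cycle. -/
def IsCycle (G : Dgraph V) : Prop := ∃ n, 3 ≤ n ∧ ∃ full, Iso G (cycleD n full)

/-- Near-chain: obtained from a chain by exchanging the directed pair formed
by its extremities. -/
def IsNearChain (G : Dgraph V) : Prop :=
  ∃ (H : Dgraph V) (m M : V), H.IsChainD ∧ m ≠ M ∧
    (∀ x, x ≠ m → H.Arc m x) ∧ (∀ x, x ≠ M → H.Arc x M) ∧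
    (∀ x y, G.Arc x y ↔ ((H.Arc x y ∧ ¬ (x = m ∧ y = M)) ∨ (x = M ∧ y = m)))

/-- `{k}`-hypomorphy. -/
def KHypo (k : ℕ) (G G' : Dgraph V) : Prop :=
  ∀ X : Set V, X.Finite → X.ncard = k → Iso (G.ind X) (G'.ind X)

/-- `(≤ k)`-hypomorphy. -/
def LeHypo (k : ℕ) (G G' : Dgraph V) : Prop :=
  ∀ j, 1 ≤ j → j ≤ k → KHypo j G G'

/-- `{k}`-hemimorphy. -/
def KHemi (k : ℕ) (G G' : Dgraph V) : Prop :=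
  ∀ X : Set V, X.Finite → X.ncard = k → Hemi (G.ind X) (G'.ind X)

/-- `(≤ k)`-hemimorphy. -/
def LeHemi (k : ℕ) (G G' : Dgraph V) : Prop :=
  ∀ j, 1 ≤ j → j ≤ k → KHemi j G G'

/-- `(≤ k)`-half-reconstructibility. -/
def HalfRecon (k : ℕ) (G : Dgraph V) : Prop :=
  ∀ G' : Dgraph V, LeHemi k G G' → Hemi G G'

/-- One step of the difference relation. -/
def DiffStep (G G' : Dgraph V) (x y : V) : Prop := G.Arc x y ↔ ¬ G'.Arc x y

/-- The difference relation `𝔇_{G,G'}`. -/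
def DiffRel (G G' : Dgraph V) (x y : V) : Prop :=
  x = y ∨ Relation.TransGen (DiffStep G G') x y

/-- Difference classes: `C ∈ D_{G,G'}`. -/
def DiffClass (G G' : Dgraph V) (C : Set V) : Prop :=
  ∃ x, C = {y | DiffRel G G' x y}

/-- The difference relation has at least two equivalence classes. -/
def AtLeastTwoDiffClasses (G G' : Dgraph V) : Prop :=
  ∃ C₁ C₂ : Set V, DiffClass G G' C₁ ∧ DiffClass G G' C₂ ∧ C₁ ≠ C₂

/-- `C_dual(G)`: the smallest cardinality of a finite set of vertices inducing a
non-self-dual subdigraph (`⊤` if there is none). -/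
noncomputable def Cdual (G : Dgraph V) : ℕ∞ :=
  sInf {n : ℕ∞ | ∃ X : Set V, X.Finite ∧ ¬ SelfDual (G.ind X) ∧ n = (X.ncard : ℕ∞)}

/-- The contracted digraph `G_I` (the vertex `none` plays the role of `I`). -/
def contract (G : Dgraph V) (I : Set V) : Dgraph (Option {x : V // x ∉ I}) where
  Arc := fun a b =>
    match a, b with
    | some x, some y => G.Arc x.1 y.1
    | some x, none => ∃ z ∈ I, G.Arc x.1 z
    | none, some y => ∃ z ∈ I, G.Arc z y.1
    | none, none => False
  irrefl := by
    rintro (_ | ⟨x, hx⟩)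
    · simp
    · exact G.irrefl x

/-- There is an isomorphism `f` from `G_I` onto `G'_I` with `f(I) = I`. -/
def ContractIsoFix (G G' : Dgraph V) (I : Set V) : Prop :=
  ∃ e : Option {x : V // x ∉ I} ≃ Option {x : V // x ∉ I},
    e none = none ∧ ∀ a b, (G.contract I).Arc a b ↔ (G'.contract I).Arc (e a) (e b)

/-- `D` is disjoint from every flag of `G`. -/
def FlagDisjoint (G : Dgraph V) (D : Set V) : Prop :=
  ∀ F : Set V, IsFlag (G.ind F) → D ∩ F = ∅

/-- `D` contains a vertex `a` of a flag `{a,b,c}` of `G` with `b, c ∉ D` and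
`{b,c}` the directed pair of the flag. -/
def FlagVertexCond (G : Dgraph V) (D : Set V) : Prop :=
  ∃ a ∈ D, ∃ b c : V, b ∉ D ∧ c ∉ D ∧ IsFlag (G.ind {a, b, c}) ∧ G.Dir b c

/-- Condition `C_∞`. -/
def CondCinf (G : Dgraph V) : Prop :=
  (∃ I : Set V, I.Infinite ∧ G.IsInterval I ∧ (G.ind I).IsChainD) ∨
  (∃ I J : Set V, I ≠ J ∧ G.IsInterval I ∧ G.IsInterval J ∧
     (G.ind I).OneEndInfiniteConsecutivity ∧ (G.ind J).OneEndInfiniteConsecutivity) ∨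
  (∃ I : Set V, G.IsInterval I ∧ (G.ind I).OneEndInfiniteConsecutivity ∧
     (∀ J : Set V, G.IsInterval J → (G.ind J).OneEndInfiniteConsecutivity → J = I) ∧
     ¬ ContractIsoFix G G.dual I)

/-- The kind of component occurring in conditions `K1` and `K2`. -/
def K12Kind (G : Dgraph V) (D : Set V) : Prop :=
  DiamondFreeTournament (G.ind D) ∨ (NonTournamentPrechain (G.ind D) ∧ G.FlagDisjoint D)

/-- Condition `K1`. -/
def CondK1 (G : Dgraph V) : Prop :=
  G.Cdual = 3 ∧ ∃ D₁ D₂ : Set V, D₁ ≠ D₂ ∧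
    (G.IsACComponent D₁ ∧ ¬ SelfDual (G.ind D₁) ∧ G.IsInterval D₁ ∧ G.K12Kind D₁) ∧
    (G.IsACComponent D₂ ∧ ¬ SelfDual (G.ind D₂) ∧ G.IsInterval D₂ ∧ G.K12Kind D₂)

/-- Condition `K2`. -/
def CondK2 (G : Dgraph V) : Prop :=
  G.Cdual = 3 ∧ ∃ D₀ : Set V, G.IsACComponent D₀ ∧ ¬ SelfDual (G.ind D₀) ∧
    (∀ D, G.IsACComponent D → ¬ SelfDual (G.ind D) → D = D₀) ∧
    G.K12Kind D₀ ∧ ¬ ContractIsoFix G G.dual D₀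

/-- Condition `K3`. -/
def CondK3 (G : Dgraph V) : Prop :=
  G.Cdual = 4 ∧ ∃ D₁ D₂ : Set V, D₁ ≠ D₂ ∧
    (G.IsACComponent D₁ ∧ ¬ SelfDual (G.ind D₁) ∧ G.IsInterval D₁) ∧
    (G.IsACComponent D₂ ∧ ¬ SelfDual (G.ind D₂) ∧ G.IsInterval D₂)

/-- Condition `K4`. -/
def CondK4 (G : Dgraph V) : Prop :=
  G.Cdual = 5 ∧ ∃ D₁ D₂ : Set V, D₁ ≠ D₂ ∧
    (G.IsACComponent D₁ ∧ ¬ SelfDual (G.ind D₁) ∧ G.IsInterval D₁ ∧ IsPrechain (G.ind D₁)) ∧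
    (G.IsACComponent D₂ ∧ ¬ SelfDual (G.ind D₂) ∧ G.IsInterval D₂ ∧ IsPrechain (G.ind D₂))

/-- Condition `K5`. -/
def CondK5 (G : Dgraph V) : Prop :=
  G.Cdual = 6 ∧ ∃ D₁ D₂ : Set V, D₁ ≠ D₂ ∧
    (G.IsACComponent D₁ ∧ ¬ SelfDual (G.ind D₁) ∧ G.IsInterval D₁ ∧
      DiamondFreeTournament (G.ind D₁)) ∧
    (G.IsACComponent D₂ ∧ ¬ SelfDual (G.ind D₂) ∧ G.IsInterval D₂ ∧
      DiamondFreeTournament (G.ind D₂))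

/-- The kind of interval occurring in conditions `L1` and `L2`. -/
def L12Int (G : Dgraph V) (I : Set V) : Prop :=
  G.IsInterval I ∧ DiamondFreeTournament (G.ind I) ∧ ¬ SelfDual (G.ind I) ∧
    ¬ G.IsACComponent I

/-- Condition `L1`. -/
def CondL1 (G : Dgraph V) : Prop :=
  ∃ I₁ I₂ : Set V, I₁ ≠ I₂ ∧ G.L12Int I₁ ∧ G.L12Int I₂

/-- Condition `L2`. -/
def CondL2 (G : Dgraph V) : Prop :=
  ∃ I₀ : Set V, G.L12Int I₀ ∧ (∀ I, G.L12Int I → I = I₀) ∧ ¬ ContractIsoFix G G.dual I₀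

/-- Condition `L3`. -/
def CondL3 (G : Dgraph V) : Prop :=
  G.Cdual = 3 ∧ ∃ D₁ D₂ : Set V, D₁ ≠ D₂ ∧
    (G.IsACComponent D₁ ∧ ¬ SelfDual (G.ind D₁) ∧ G.IsInterval D₁) ∧
    (G.IsACComponent D₂ ∧ ¬ SelfDual (G.ind D₂) ∧ G.IsInterval D₂) ∧
    ((G.FlagDisjoint D₁ ∧ Cdual (G.ind D₁) = 4 ∧ G.FlagDisjoint D₂ ∧ Cdual (G.ind D₂) = 4) ∨
     (NonTournamentPrechain (G.ind D₁) ∧ G.FlagVertexCond D₁ ∧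
      NonTournamentPrechain (G.ind D₂) ∧ G.FlagVertexCond D₂))

/-- Condition `L4`. -/
def CondL4 (G : Dgraph V) : Prop :=
  G.Cdual = 3 ∧ ∃ D₀ : Set V, G.IsACComponent D₀ ∧ ¬ SelfDual (G.ind D₀) ∧
    (∀ D, G.IsACComponent D → ¬ SelfDual (G.ind D) → D = D₀) ∧
    G.IsInterval D₀ ∧
    ((G.FlagDisjoint D₀ ∧ Cdual (G.ind D₀) = 4) ∨
     (NonTournamentPrechain (G.ind D₀) ∧ G.FlagVertexCond D₀)) ∧
    ¬ ContractIsoFix G G.dual D₀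

end Dgraph

namespace Dgraph

/-- The joint isomorphism type of an ordered pair in two digraphs with the same directed pairs:
`keepFwd` is an arc of both digraphs, `flipFwd` an arc of the first one reversed in the second,
and similarly for the two backward types. -/
inductive PairType
  | void | full | keepFwd | keepBwd | flipFwd | flipBwd
  deriving DecidableEq

namespace PairType

/-- The type of the pair read in the opposite order. -/
def swap : PairType → PairType
  | void => void
  | full => full
  | keepFwd => keepBwd
  | keepBwd => keepFwd
  | flipFwd => flipBwd
  | flipBwd => flipFwd

/-- An injective numbering of the types. -/
def rank : PairType → ℕ
  | void => 0
  | full => 1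
  | keepFwd => 2
  | keepBwd => 3
  | flipFwd => 4
  | flipBwd => 5

/-- The type of the pair in the first digraph. -/
def fst : PairType → PairType
  | flipFwd => keepFwd
  | flipBwd => keepBwd
  | t => t

/-- The type of the pair in the second digraph. -/
def snd : PairType → PairType
  | flipFwd => keepBwd
  | flipBwd => keepFwd
  | t => t

/-- The pair is directed, in opposite ways in the two digraphs. -/
def Flip (t : PairType) : Prop := t = flipFwd ∨ t = flipBwd

/-- The pair is full or void. -/
def Neutral (t : PairType) : Prop := t = void ∨ t = full

instance (t : PairType) : Decidable t.Neutral := inferInstanceAs (Decidable (_ ∨ _))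

instance (t : PairType) : Decidable t.Flip := inferInstanceAs (Decidable (_ ∨ _))

instance decidableForall (p : PairType → Prop) [DecidablePred p] : Decidable (∀ t, p t) :=
  decidable_of_iff
    (p void ∧ p full ∧ p keepFwd ∧ p keepBwd ∧ p flipFwd ∧ p flipBwd)
    ⟨fun ⟨h₁, h₂, h₃, h₄, h₅, h₆⟩ t => by cases t <;> assumption,
      fun h => ⟨h _, h _, h _, h _, h _, h _⟩⟩

end PairType

open PairType

/-- Whether two triples of pair types, for the pairs `01, 12, 20`, are equal up to a
relabelling of the three vertices. -/
def isoTriple (a b c a' b' c' : PairType) : Bool :=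
  (a == a' && b == b' && c == c') || (a == b' && b == c' && c == a') ||
  (a == c' && b == a' && c == b') ||
  (a == c'.swap && b == b'.swap && c == a'.swap) ||
  (a == b'.swap && b == a'.swap && c == c'.swap) ||
  (a == a'.swap && b == c'.swap && c == b'.swap)

/-- How a triple of vertices compares in two digraphs. -/
inductive TripleKind
  | selfDual | kept | flipped | bad
  deriving DecidableEq

/-- The kind of a triple, given the types of the pairs `01, 12, 20`. -/
def tripleKind (a b c : PairType) : TripleKind :=
  if isoTriple a.fst b.fst c.fst a.snd b.snd c.snd then
    if isoTriple a.fst b.fst c.fst a.fst.swap b.fst.swap c.fst.swap then .selfDual else .kept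
  else
    if isoTriple a.fst.swap b.fst.swap c.fst.swap a.snd b.snd c.snd then .flipped else .bad

/-- `consistent A B k c p`: mapping the vertices `p.length - 1, …, 0` to the members of `p` and `k`
to `c` respects the tables `A` and `B` on the pairs containing `k`. -/
def consistent (A B : ℕ → ℕ → PairType) (k c : ℕ) : List ℕ → Bool
  | [] => true
  | d :: p => A p.length k == B d c && consistent A B k c p

/-- Search for `r` further images extending the partial isomorphism `p` between the tables `A` and
`B` on `n` vertices. -/
def extendable (A B : ℕ → ℕ → PairType) (n : ℕ) : ℕ → List ℕ → Bool
  | 0, _ => true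
  | r + 1, p => (List.range n).any fun c =>
      !p.contains c && (consistent A B p.length c p && extendable A B n r (c :: p))

/-- Whether the two digraphs on `n` vertices described by the table `M` are hemimorphic. -/
def hemiTable (M : ℕ → ℕ → PairType) (n : ℕ) : Bool :=
  extendable (fun i j => (M i j).fst) (fun i j => (M i j).snd) n n [] ||
  extendable (fun i j => (M i j).fst.swap) (fun i j => (M i j).snd) n n []

/-- The entry of a list at a given index. -/
def entry {α : Type*} (d : α) : List α → ℕ → α
  | [], _ => d
  | a :: _, 0 => a
  | _ :: l, i + 1 => entry d l i

/-- The table with the given rows. -/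
def ofRows (l : List (List PairType)) (i j : ℕ) : PairType := entry void (entry [] l i) j

/-- The table on three vertices given by its pairs. -/
def table₃ (t₀₁ t₁₂ t₂₀ : PairType) : ℕ → ℕ → PairType := ofRows
  [[void, t₀₁, t₂₀.swap], [t₀₁.swap, void, t₁₂], [t₂₀, t₁₂.swap, void]]

/-- The table on four vertices given by its pairs. -/
def table₄ (t₀₁ t₀₂ t₀₃ t₁₂ t₁₃ t₂₃ : PairType) : ℕ → ℕ → PairType := ofRows
  [[void, t₀₁, t₀₂, t₀₃], [t₀₁.swap, void, t₁₂, t₁₃], [t₀₂.swap, t₁₂.swap, void, t₂₃],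
    [t₀₃.swap, t₁₃.swap, t₂₃.swap, void]]

/-- The table on five vertices given by its pairs. -/
def table₅ (t₀₁ t₀₂ t₀₃ t₀₄ t₁₂ t₁₃ t₁₄ t₂₃ t₂₄ t₃₄ : PairType) : ℕ → ℕ → PairType := ofRows
  [[void, t₀₁, t₀₂, t₀₃, t₀₄], [t₀₁.swap, void, t₁₂, t₁₃, t₁₄],
    [t₀₂.swap, t₁₂.swap, void, t₂₃, t₂₄], [t₀₃.swap, t₁₃.swap, t₂₃.swap, void, t₃₄],
    [t₀₄.swap, t₁₄.swap, t₂₄.swap, t₃₄.swap, void]]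

theorem hemiTable_four_eq_false : ∀ t₀₁ t₁₂ t₀₂ : PairType, tripleKind t₀₁ t₁₂ t₀₂.swap = .kept →
    ∀ t₁₃ t₀₃, tripleKind t₀₁ t₁₃ t₀₃.swap = .flipped →
    ∀ t₂₃, tripleKind t₀₂ t₂₃ t₀₃.swap ≠ .bad → tripleKind t₁₂ t₂₃ t₁₃.swap ≠ .bad →
    hemiTable (table₄ t₀₁ t₀₂ t₀₃ t₁₂ t₁₃ t₂₃) 4 = false := by
  decide +kernel

set_option synthInstance.maxSize 1000 in
set_option synthInstance.maxHeartbeats 200000 in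
theorem hemiTable_five_eq_false : ∀ t₀₁ t₁₂ t₀₂ : PairType, tripleKind t₀₁ t₁₂ t₀₂.swap = .kept →
    t₀₁.rank ≤ t₀₂.rank →
    ∀ t₀₃ t₃₄ t₀₄, tripleKind t₀₃ t₃₄ t₀₄.swap = .flipped → t₀₃.rank ≤ t₀₄.rank →
    ∀ t₁₃, tripleKind t₀₁ t₁₃ t₀₃.swap = .selfDual →
    ∀ t₁₄, tripleKind t₀₁ t₁₄ t₀₄.swap = .selfDual →
    tripleKind t₁₃ t₃₄ t₁₄.swap ≠ .bad → tripleKind t₁₃ t₃₄ t₁₄.swap ≠ .kept →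
    ∀ t₂₃, tripleKind t₀₂ t₂₃ t₀₃.swap = .selfDual →
    tripleKind t₁₂ t₂₃ t₁₃.swap ≠ .bad → tripleKind t₁₂ t₂₃ t₁₃.swap ≠ .flipped →
    ∀ t₂₄, tripleKind t₀₂ t₂₄ t₀₄.swap = .selfDual →
    tripleKind t₁₂ t₂₄ t₁₄.swap ≠ .bad → tripleKind t₁₂ t₂₄ t₁₄.swap ≠ .flipped →
    tripleKind t₂₃ t₃₄ t₂₄.swap ≠ .bad → tripleKind t₂₃ t₃₄ t₂₄.swap ≠ .kept →
    hemiTable (table₄ t₁₂ t₁₃ t₁₄ t₂₃ t₂₄ t₃₄) 4 = true →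
    hemiTable (table₅ t₀₁ t₀₂ t₀₃ t₀₄ t₁₂ t₁₃ t₁₄ t₂₃ t₂₄ t₃₄) 5 = false := by
  decide +kernel

theorem exists_perm_of_tripleKind_eq_selfDual : ∀ a b c, tripleKind a b c = .selfDual →
    ∃ σ : Equiv.Perm (Fin 3), ∀ i j : Fin 3,
      (table₃ a b c i j).fst = (table₃ a b c (σ j) (σ i)).fst := by
  decide +kernel

theorem exists_perm_of_tripleKind_eq_kept : ∀ a b c, tripleKind a b c = .kept →
    (∃ σ : Equiv.Perm (Fin 3), ∀ i j : Fin 3,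
      (table₃ a b c i j).fst = (table₃ a b c (σ i) (σ j)).snd) ∧
    ¬ ∃ σ : Equiv.Perm (Fin 3), ∀ i j : Fin 3,
      (table₃ a b c i j).fst = (table₃ a b c (σ j) (σ i)).fst := by
  decide +kernel

theorem not_exists_perm_of_tripleKind_eq_flipped : ∀ a b c, tripleKind a b c = .flipped →
    (¬ ∃ σ : Equiv.Perm (Fin 3), ∀ i j : Fin 3,
      (table₃ a b c i j).fst = (table₃ a b c (σ i) (σ j)).snd) ∧
    ¬ ∃ σ : Equiv.Perm (Fin 3), ∀ i j : Fin 3,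
      (table₃ a b c i j).fst = (table₃ a b c (σ j) (σ i)).fst := by
  decide +kernel

theorem not_exists_perm_of_tripleKind_eq_bad : ∀ a b c, tripleKind a b c = .bad →
    (¬ ∃ σ : Equiv.Perm (Fin 3), ∀ i j : Fin 3,
      (table₃ a b c i j).fst = (table₃ a b c (σ i) (σ j)).snd) ∧
    ¬ ∃ σ : Equiv.Perm (Fin 3), ∀ i j : Fin 3,
      (table₃ a b c j i).fst = (table₃ a b c (σ i) (σ j)).snd := by
  decide +kernel

/-- A vertex outside a flipped pair and joined to it by no flipped pair sees both of its ends in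
the same way, unless the three vertices form a flipped triple. -/
theorem eq_of_flip : ∀ xy yz, yz.Flip → ∀ xz, ¬ xy.Flip → ¬ xz.Flip →
    tripleKind xy yz xz.swap ≠ .bad → tripleKind xy yz xz.swap ≠ .flipped → xy = xz := by
  decide +kernel

/-- A kept triple has a neutral pair and a directed pair meeting in one vertex. -/
theorem exists_neutral_directed_of_kept : ∀ a b c, tripleKind a b c = .kept →
    (b.Neutral ∧ ¬ a.Neutral) ∨ (b.Neutral ∧ ¬ c.Neutral) ∨
    (c.Neutral ∧ ¬ b.Neutral) ∨ (c.Neutral ∧ ¬ a.Neutral) ∨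
    (a.Neutral ∧ ¬ c.Neutral) ∨ (a.Neutral ∧ ¬ b.Neutral) := by
  decide +kernel

set_option synthInstance.maxSize 1000 in
theorem eq_and_eq_of_flip : ∀ mp pq mq, tripleKind mp pq mq.swap = .kept → pq.Neutral →
    ¬ mq.Neutral → ∀ em, em.Flip →
    ∀ ep, tripleKind em mp ep.swap ≠ .bad → tripleKind em mp ep.swap ≠ .flipped →
    ∀ eq, tripleKind em mq eq.swap ≠ .bad → tripleKind em mq eq.swap ≠ .flipped →
    tripleKind ep pq eq.swap ≠ .bad → tripleKind ep pq eq.swap ≠ .flipped →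
    hemiTable (table₄ em ep eq mp mq pq) 4 = true → ep = mp ∧ eq = mq := by
  decide +kernel


theorem not_flip_of_kept : ∀ mp pq mq : PairType, tripleKind mp pq mq.swap = .kept →
    pq.Neutral → ¬ mq.Neutral → ¬ mp.Flip ∧ ¬ mq.Flip := by
  decide +kernel
theorem extendable_of_perm {n : ℕ} {A B : ℕ → ℕ → PairType} (σ : Equiv.Perm (Fin n))
    (h : ∀ i j : Fin n, A i j = B (σ i) (σ j)) : extendable A B n n [] = true := by
  let τ : ℕ → ℕ := fun i => if hi : i < n then σ ⟨i, hi⟩ else i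
  have hτ (i : Fin n) : τ i = σ i := by simp [τ]
  have hcons : ∀ k m, m ≤ k → k < n →
      consistent A B k (τ k) ((List.range m).map τ).reverse = true := by
    intro k m hm hk
    induction m with
    | zero => simp [consistent]
    | succ m ih =>
      simp only [List.range_succ, List.map_append, List.map_cons, List.map_nil,
        List.reverse_append, List.reverse_cons, List.reverse_nil, List.nil_append,
        List.cons_append, consistent, Bool.and_eq_true, beq_iff_eq]
      refine ⟨?_, ih (by omega)⟩
      have := h ⟨m, by omega⟩ ⟨k, hk⟩
      rw [← hτ, ← hτ] at this
      simpa using this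
  have key : ∀ r k, k + r = n → extendable A B n r ((List.range k).map τ).reverse = true := by
    intro r
    induction r with
    | zero => intros; rfl
    | succ r ih =>
      intro k hk
      have hkn : k < n := by omega
      simp only [extendable, List.any_eq_true, List.mem_range, Bool.and_eq_true]
      refine ⟨τ k, ?_, ?_, ?_, ?_⟩
      · have := hτ ⟨k, hkn⟩
        simp only at this
        rw [this]
        exact Fin.is_lt _
      · simp only [Bool.not_eq_true', List.contains_eq_mem, decide_eq_false_iff_not,
          List.mem_reverse, List.mem_map, List.mem_range, not_exists, not_and]
        intro i hi hik
        have h₁ := hτ ⟨i, by omega⟩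
        have h₂ := hτ ⟨k, hkn⟩
        simp only at h₁ h₂
        rw [h₁, h₂, ← Fin.ext_iff, σ.injective.eq_iff, Fin.mk.injEq] at hik
        omega
      · simpa using hcons k k le_rfl hkn
      · have := ih (k + 1) (by omega)
        simpa [List.range_succ] using this
  simpa using key n 0 (by simp)

/-- Isomorphisms between two digraphs induced on the same finite set, in terms of an enumeration
of that set. -/
theorem iso_ind_range {V : Type u} {n : ℕ} (G H : Dgraph V) {w : Fin n → V}
    (hw : Function.Injective w) :
    Iso (G.ind (Set.range w)) (H.ind (Set.range w)) ↔
      ∃ σ : Equiv.Perm (Fin n), ∀ i j, G.Arc (w i) (w j) ↔ H.Arc (w (σ i)) (w (σ j)) := by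
  let f : Fin n ≃ Set.range w := Equiv.ofInjective w hw
  have hf (i : Fin n) : (f i : V) = w i := rfl
  constructor
  · rintro ⟨e, he⟩
    refine ⟨(f.trans e).trans f.symm, fun i j => ?_⟩
    have := he (f i) (f j)
    rw [← hf ((f.trans e).trans f.symm i), ← hf ((f.trans e).trans f.symm j)]
    simpa [ind, hf] using this
  · rintro ⟨σ, hσ⟩
    refine ⟨(f.symm.trans σ).trans f, fun x y => ?_⟩
    obtain ⟨i, rfl⟩ := f.surjective x
    obtain ⟨j, rfl⟩ := f.surjective y
    simpa [ind, hf] using hσ i j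

open Classical in
/-- The joint type of an ordered pair of vertices in two digraphs. -/
noncomputable def pairType {V : Type u} (G G' : Dgraph V) (x y : V) : PairType :=
  if G.Arc x y then
    if G.Arc y x then full else if G'.Arc x y then keepFwd else flipFwd
  else
    if G.Arc y x then if G'.Arc y x then keepBwd else flipBwd else void

section PairTypeLemmas

variable {V : Type u} {G G' H : Dgraph V} {x y x' y' : V}

/-- The two digraphs have the same full pairs and the same void pairs. -/
def SamePairs (G G' : Dgraph V) : Prop :=
  ∀ x y, ((G.Arc x y ∧ G.Arc y x) ↔ (G'.Arc x y ∧ G'.Arc y x)) ∧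
    ((G.Arc x y ∨ G.Arc y x) ↔ (G'.Arc x y ∨ G'.Arc y x))

@[simp]
theorem pairType_self_void (x : V) : pairType G G' x x = void := by
  simp [pairType, G.irrefl]

theorem pairType_eq_iff : pairType G G x y = pairType H H x' y' ↔
    ((G.Arc x y ↔ H.Arc x' y') ∧ (G.Arc y x ↔ H.Arc y' x')) := by
  unfold pairType
  split_ifs <;> simp_all

theorem fst_pairType : (pairType G G' x y).fst = pairType G G x y := by
  unfold pairType
  split_ifs <;> simp_all [PairType.fst]

theorem snd_pairType (h : SamePairs G G') : (pairType G G' x y).snd = pairType G' G' x y := by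
  have := h x y
  unfold pairType
  split_ifs <;> simp_all [PairType.snd]

theorem swap_pairType (h : SamePairs G G') (x y : V) :
    (pairType G G' x y).swap = pairType G G' y x := by
  have := h x y
  unfold pairType
  split_ifs <;> simp_all [PairType.swap]

theorem flip_pairType_iff (h : SamePairs G G') :
    (pairType G G' x y).Flip ↔ DiffStep G G' x y := by
  have := h x y
  unfold pairType PairType.Flip DiffStep
  split_ifs <;> simp_all

theorem dir_of_not_neutral_pairType (h : ¬ (pairType G G' x y).Neutral) : G.Dir x y := by
  unfold pairType PairType.Neutral at h
  unfold Dir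
  split_ifs at h <;> simp_all

theorem not_neutral_of_flip {t : PairType} (h : t.Flip) : ¬ t.Neutral := by
  rcases h with rfl | rfl <;> simp [PairType.Neutral]

theorem exists_perm_fst {n : ℕ} {w : Fin n → V} (hw : Function.Injective w) (h : SamePairs G G')
    {M : ℕ → ℕ → PairType} (hM : ∀ i j : Fin n, M i j = pairType G G' (w i) (w j)) :
    Iso (G.ind (Set.range w)) (G'.ind (Set.range w)) ↔
      ∃ σ : Equiv.Perm (Fin n), ∀ i j : Fin n, (M i j).fst = (M (σ i) (σ j)).snd := by
  rw [iso_ind_range _ _ hw]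
  refine exists_congr fun σ => ⟨fun H i j => ?_, fun H i j => ?_⟩
  · rw [hM, hM, fst_pairType, snd_pairType h, pairType_eq_iff]
    exact ⟨H i j, H j i⟩
  · have := H i j
    rw [hM, hM, fst_pairType, snd_pairType h, pairType_eq_iff] at this
    exact this.1

theorem exists_perm_swap {n : ℕ} {w : Fin n → V} (hw : Function.Injective w) (h : SamePairs G G')
    {M : ℕ → ℕ → PairType} (hM : ∀ i j : Fin n, M i j = pairType G G' (w i) (w j)) :
    Iso (G.dual.ind (Set.range w)) (G'.ind (Set.range w)) ↔
      ∃ σ : Equiv.Perm (Fin n), ∀ i j : Fin n, (M j i).fst = (M (σ i) (σ j)).snd := by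
  rw [iso_ind_range _ _ hw]
  refine exists_congr fun σ => ⟨fun H i j => ?_, fun H i j => ?_⟩
  · rw [hM, hM, fst_pairType, snd_pairType h, pairType_eq_iff]
    exact ⟨H i j, H j i⟩
  · have := H i j
    rw [hM, hM, fst_pairType, snd_pairType h, pairType_eq_iff] at this
    exact this.1

theorem exists_perm_dual {n : ℕ} {w : Fin n → V} (hw : Function.Injective w)
    {M : ℕ → ℕ → PairType} (hM : ∀ i j : Fin n, M i j = pairType G G' (w i) (w j)) :
    SelfDual (G.ind (Set.range w)) ↔
      ∃ σ : Equiv.Perm (Fin n), ∀ i j : Fin n, (M i j).fst = (M (σ j) (σ i)).fst := by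
  have : SelfDual (G.ind (Set.range w)) ↔
    Iso (G.ind (Set.range w)) (G.dual.ind (Set.range w)) := Iff.rfl
  rw [this, iso_ind_range _ _ hw]
  refine exists_congr fun σ => ⟨fun H i j => ?_, fun H i j => ?_⟩
  · rw [hM, hM, fst_pairType, fst_pairType, pairType_eq_iff]
    exact ⟨H i j, H j i⟩
  · have := H i j
    rw [hM, hM, fst_pairType, fst_pairType, pairType_eq_iff] at this
    exact this.1

theorem PairType.fst_swap (t : PairType) : t.swap.fst = t.fst.swap := by
  cases t <;> rfl

theorem hemiTable_eq_true {n : ℕ} {w : Fin n → V} (hw : Function.Injective w)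
    (h : SamePairs G G') {M : ℕ → ℕ → PairType}
    (hM : ∀ i j : Fin n, M i j = pairType G G' (w i) (w j))
    (hG : Hemi (G.ind (Set.range w)) (G'.ind (Set.range w))) : hemiTable M n = true := by
  rw [hemiTable, Bool.or_eq_true]
  rcases hG with hG | hG
  · obtain ⟨σ, hσ⟩ := (exists_perm_fst hw h hM).1 hG
    exact .inl (extendable_of_perm σ hσ)
  · obtain ⟨σ, hσ⟩ := (exists_perm_swap hw h hM).1 hG
    refine .inr (extendable_of_perm σ fun i j => ?_)
    rw [← hσ, ← PairType.fst_swap, hM, hM, swap_pairType h]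

end PairTypeLemmas

variable {V : Type u} {G G' : Dgraph V}

theorem LeHemi.hemi_range {k n : ℕ} (h : LeHemi k G G') (hn : 1 ≤ n) (hk : n ≤ k)
    {w : Fin n → V} (hw : Function.Injective w) :
    Hemi (G.ind (Set.range w)) (G'.ind (Set.range w)) :=
  h n hn hk _ (Set.finite_range w) (by
    rw [← Set.image_univ, Set.ncard_image_of_injective _ hw, Set.ncard_univ, Nat.card_fin])

theorem injective_two {x y : V} (h : x ≠ y) : Function.Injective ![x, y] := by
  intro i j hij
  fin_cases i <;> fin_cases j <;> simp_all

theorem injective_three {x y z : V} (hxy : x ≠ y) (hxz : x ≠ z) (hyz : y ≠ z) :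
    Function.Injective ![x, y, z] := by
  intro i j hij
  fin_cases i <;> fin_cases j <;> simp_all

theorem range_three (x y z : V) : Set.range ![x, y, z] = {x, y, z} := by
  ext v
  simp [eq_comm]
  tauto

theorem LeHemi.samePairs {k : ℕ} (h : LeHemi k G G') (hk : 2 ≤ k) : SamePairs G G' := by
  intro x y
  rcases eq_or_ne x y with rfl | hxy
  · simp [G.irrefl, G'.irrefl]
  have hw := injective_two hxy
  have key : ∀ H : Dgraph V, Iso (H.ind (Set.range ![x, y])) (G'.ind (Set.range ![x, y])) →
      ((H.Arc x y ∧ H.Arc y x) ↔ (G'.Arc x y ∧ G'.Arc y x)) ∧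
      ((H.Arc x y ∨ H.Arc y x) ↔ (G'.Arc x y ∨ G'.Arc y x)) := by
    intro H hH
    obtain ⟨σ, hσ⟩ := (iso_ind_range _ _ hw).1 hH
    have h₁ := hσ 0 1
    have h₂ := hσ 1 0
    have h₃ : σ 0 ≠ σ 1 := by simp
    generalize σ 0 = a at *
    generalize σ 1 = b at *
    fin_cases a <;> fin_cases b <;> simp_all [and_comm, or_comm]
  rcases h.hemi_range (by norm_num) hk hw with H | H
  · exact key G H
  · have := key G.dual H
    simp only [dual] at this
    tauto

/-- A triple that is not self-dual and induces isomorphic digraphs. -/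
def Kept (G G' : Dgraph V) (T : Set V) : Prop :=
  ¬ SelfDual (G.ind T) ∧ Iso (G.ind T) (G'.ind T)

/-- A triple that is not self-dual and induces non-isomorphic digraphs. -/
def Flipped (G G' : Dgraph V) (T : Set V) : Prop :=
  ¬ SelfDual (G.ind T) ∧ ¬ Iso (G.ind T) (G'.ind T)

/-- The kind of the triple `x, y, z`. -/
noncomputable def kind (G G' : Dgraph V) (x y z : V) : TripleKind :=
  tripleKind (pairType G G' x y) (pairType G G' y z) (pairType G G' x z).swap

section Triples

variable {x y z : V}

theorem table₃_pairType (h : SamePairs G G') (x y z : V) (i j : Fin 3) :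
    table₃ (pairType G G' x y) (pairType G G' y z) (pairType G G' x z).swap i j =
      pairType G G' (![x, y, z] i) (![x, y, z] j) := by
  simp only [table₃, swap_pairType h]
  fin_cases i <;> fin_cases j <;> simp [ofRows, entry]

theorem table₄_pairType (h : SamePairs G G') (a b c d : V) (i j : Fin 4) :
    table₄ (pairType G G' a b) (pairType G G' a c) (pairType G G' a d) (pairType G G' b c)
      (pairType G G' b d) (pairType G G' c d) i j =
      pairType G G' (![a, b, c, d] i) (![a, b, c, d] j) := by
  simp only [table₄, swap_pairType h]
  fin_cases i <;> fin_cases j <;> simp [ofRows, entry]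

theorem table₅_pairType (h : SamePairs G G') (a b c d e : V) (i j : Fin 5) :
    table₅ (pairType G G' a b) (pairType G G' a c) (pairType G G' a d) (pairType G G' a e)
      (pairType G G' b c) (pairType G G' b d) (pairType G G' b e) (pairType G G' c d)
      (pairType G G' c e) (pairType G G' d e) i j =
      pairType G G' (![a, b, c, d, e] i) (![a, b, c, d, e] j) := by
  simp only [table₅, swap_pairType h]
  fin_cases i <;> fin_cases j <;> simp [ofRows, entry]

theorem LeHemi.hemiTable_four (h : LeHemi 6 G G') {a b c d : V} (hab : a ≠ b) (hac : a ≠ c)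
    (had : a ≠ d) (hbc : b ≠ c) (hbd : b ≠ d) (hcd : c ≠ d) :
    hemiTable (table₄ (pairType G G' a b) (pairType G G' a c) (pairType G G' a d)
      (pairType G G' b c) (pairType G G' b d) (pairType G G' c d)) 4 = true := by
  have hw : Function.Injective ![a, b, c, d] := by
    intro i j hij
    fin_cases i <;> fin_cases j <;> simp_all
  exact hemiTable_eq_true hw (h.samePairs (by norm_num))
    (table₄_pairType (h.samePairs (by norm_num)) a b c d)
    (h.hemi_range (by norm_num) (by norm_num) hw)

theorem LeHemi.hemiTable_five (h : LeHemi 6 G G') {a b c d e : V} (hab : a ≠ b) (hac : a ≠ c)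
    (had : a ≠ d) (hae : a ≠ e) (hbc : b ≠ c) (hbd : b ≠ d) (hbe : b ≠ e) (hcd : c ≠ d)
    (hce : c ≠ e) (hde : d ≠ e) :
    hemiTable (table₅ (pairType G G' a b) (pairType G G' a c) (pairType G G' a d)
      (pairType G G' a e) (pairType G G' b c) (pairType G G' b d) (pairType G G' b e)
      (pairType G G' c d) (pairType G G' c e) (pairType G G' d e)) 5 = true := by
  have hw : Function.Injective ![a, b, c, d, e] := by
    intro i j hij
    fin_cases i <;> fin_cases j <;> simp_all
  exact hemiTable_eq_true hw (h.samePairs (by norm_num))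
    (table₅_pairType (h.samePairs (by norm_num)) a b c d e)
    (h.hemi_range (by norm_num) (by norm_num) hw)

theorem LeHemi.kind_ne_bad (h : LeHemi 6 G G') (hxy : x ≠ y) (hxz : x ≠ z) (hyz : y ≠ z) :
    kind G G' x y z ≠ .bad := by
  intro hk
  have hw := injective_three hxy hxz hyz
  have hp := h.samePairs (by norm_num)
  obtain ⟨h₁, h₂⟩ := not_exists_perm_of_tripleKind_eq_bad _ _ _ hk
  rcases h.hemi_range (by norm_num) (by norm_num) hw with H | H
  · exact h₁ ((exists_perm_fst hw hp (table₃_pairType hp x y z)).1 H)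
  · exact h₂ ((exists_perm_swap hw hp (table₃_pairType hp x y z)).1 H)

theorem LeHemi.kind_spec (h : LeHemi 6 G G') (hxy : x ≠ y) (hxz : x ≠ z) (hyz : y ≠ z) :
    (kind G G' x y z = .selfDual ∧ SelfDual (G.ind {x, y, z})) ∨
    (kind G G' x y z = .kept ∧ Kept G G' {x, y, z}) ∨
    (kind G G' x y z = .flipped ∧ Flipped G G' {x, y, z}) := by
  have hw := injective_three hxy hxz hyz
  have hp := h.samePairs (by norm_num)
  have hM := table₃_pairType hp x y z
  rw [Kept, Flipped, ← range_three, exists_perm_dual hw hM, exists_perm_fst hw hp hM]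
  rcases hk : kind G G' x y z
  · exact .inl ⟨rfl, exists_perm_of_tripleKind_eq_selfDual _ _ _ hk⟩
  · exact .inr (.inl ⟨rfl, (exists_perm_of_tripleKind_eq_kept _ _ _ hk).symm⟩)
  · exact .inr (.inr ⟨rfl, (not_exists_perm_of_tripleKind_eq_flipped _ _ _ hk).symm⟩)
  · exact (h.kind_ne_bad hxy hxz hyz hk).elim

theorem LeHemi.kind_eq_kept_iff (h : LeHemi 6 G G') (hxy : x ≠ y) (hxz : x ≠ z) (hyz : y ≠ z) :
    kind G G' x y z = .kept ↔ Kept G G' {x, y, z} := by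
  rcases h.kind_spec hxy hxz hyz with ⟨h₁, h₂⟩ | ⟨h₁, h₂⟩ | ⟨h₁, h₂⟩ <;>
    simp_all [Kept, Flipped]

theorem LeHemi.kind_eq_flipped_iff (h : LeHemi 6 G G') (hxy : x ≠ y) (hxz : x ≠ z)
    (hyz : y ≠ z) : kind G G' x y z = .flipped ↔ Flipped G G' {x, y, z} := by
  rcases h.kind_spec hxy hxz hyz with ⟨h₁, h₂⟩ | ⟨h₁, h₂⟩ | ⟨h₁, h₂⟩ <;>
    simp_all [Kept, Flipped]

theorem LeHemi.kind_eq_selfDual (h : LeHemi 6 G G') (hxy : x ≠ y) (hxz : x ≠ z)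
    (hyz : y ≠ z) (hk : ¬ Kept G G' {x, y, z}) (hf : ¬ Flipped G G' {x, y, z}) :
    kind G G' x y z = .selfDual := by
  rcases h.kind_spec hxy hxz hyz with ⟨h₁, h₂⟩ | ⟨h₁, h₂⟩ | ⟨h₁, h₂⟩
  · exact h₁
  · exact (hk h₂).elim
  · exact (hf h₂).elim

end Triples

theorem LeHemi.not_kept_flipped_of_two_common (h : LeHemi 6 G G') {a b c d : V} (hab : a ≠ b)
    (hac : a ≠ c) (had : a ≠ d) (hbc : b ≠ c) (hbd : b ≠ d) (hcd : c ≠ d)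
    (hT : Kept G G' {a, b, c}) (hT' : Flipped G G' {a, b, d}) : False := by
  have h₄ := h.hemiTable_four hab hac had hbc hbd hcd
  rw [hemiTable_four_eq_false _ _ _ ((h.kind_eq_kept_iff hab hac hbc).2 hT) _ _
    ((h.kind_eq_flipped_iff hab had hbd).2 hT') _ (h.kind_ne_bad hac had hcd)
    (h.kind_ne_bad hbc hbd hcd)] at h₄
  exact Bool.false_ne_true h₄

theorem LeHemi.not_kept_flipped_of_one_common (h : LeHemi 6 G G') {a b c d e : V} (hab : a ≠ b)
    (hac : a ≠ c) (had : a ≠ d) (hae : a ≠ e) (hbc : b ≠ c) (hbd : b ≠ d) (hbe : b ≠ e)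
    (hcd : c ≠ d) (hce : c ≠ e) (hde : d ≠ e)
    (hT : Kept G G' {a, b, c}) (hT' : Flipped G G' {a, d, e}) : False := by
  wlog hr : (pairType G G' a b).rank ≤ (pairType G G' a c).rank generalizing b c
  · exact this hac hab hbc.symm hcd hce hbd hbe (by rwa [Set.pair_comm c b]) (by omega)
  wlog hr' : (pairType G G' a d).rank ≤ (pairType G G' a e).rank generalizing d e
  · exact this hae had hde.symm (by rwa [Set.pair_comm e d]) hbe hbd hce hcd (by omega)
  have two := @LeHemi.not_kept_flipped_of_two_common V G G' h
  have sd : ∀ {i j}, a ≠ i → a ≠ j → i ≠ j → (∃ k, a ≠ k ∧ i ≠ k ∧ j ≠ k ∧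
      Kept G G' {a, i, k}) → (∃ k, a ≠ k ∧ i ≠ k ∧ j ≠ k ∧ Flipped G G' {a, j, k}) →
      kind G G' a i j = .selfDual := by
    rintro i j hai haj hij ⟨k, hak, hik, hjk, hk⟩ ⟨l, hal, hil, hjl, hl⟩
    refine h.kind_eq_selfDual hai haj hij (fun H => ?_) (fun H => ?_)
    · rw [Set.pair_comm] at H
      exact two haj hai hal hij.symm hjl hil H hl
    · exact two hai hak haj hik hij hjk.symm hk H
  have hTc : Kept G G' {a, c, b} := by rwa [Set.pair_comm c b]
  have hTe : Flipped G G' {a, e, d} := by rwa [Set.pair_comm e d]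
  have hT₁ : Kept G G' {b, c, a} := by
    rwa [Set.pair_comm c a, Set.insert_comm b a]
  have hT₂ : Flipped G G' {d, e, a} := by
    rwa [Set.pair_comm e a, Set.insert_comm d a]
  have nf : ∀ {j}, a ≠ j → b ≠ j → c ≠ j → kind G G' b c j ≠ .flipped := by
    intro j haj hbj hcj H
    exact two hbc hab.symm hbj hac.symm hcj haj hT₁ ((h.kind_eq_flipped_iff hbc hbj hcj).1 H)
  have nk : ∀ {j}, a ≠ j → j ≠ d → j ≠ e → kind G G' j d e ≠ .kept := by
    intro j haj hjd hje H
    refine two hde hjd.symm had.symm hje.symm hae.symm haj.symm ?_ hT₂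
    have := (h.kind_eq_kept_iff hjd hje hde).1 H
    rwa [Set.pair_comm e j, Set.insert_comm d j]
  have h₅ := h.hemiTable_five hab hac had hae hbc hbd hbe hcd hce hde
  rw [hemiTable_five_eq_false _ _ _ ((h.kind_eq_kept_iff hab hac hbc).2 hT) hr _ _ _
    ((h.kind_eq_flipped_iff had hae hde).2 hT') hr'
    _ (sd hab had hbd ⟨c, hac, hbc, hcd.symm, hT⟩ ⟨e, hae, hbe, hde, hT'⟩)
    _ (sd hab hae hbe ⟨c, hac, hbc, hce.symm, hT⟩ ⟨d, had, hbd, hde.symm, hTe⟩)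
    (h.kind_ne_bad hbd hbe hde) (nk hab hbd hbe)
    _ (sd hac had hcd ⟨b, hab, hbc.symm, hbd.symm, hTc⟩ ⟨e, hae, hce, hde, hT'⟩)
    (h.kind_ne_bad hbc hbd hcd) (nf had hbd hcd)
    _ (sd hac hae hce ⟨b, hab, hbc.symm, hbe.symm, hTc⟩ ⟨d, had, hcd, hde.symm, hTe⟩)
    (h.kind_ne_bad hbc hbe hce) (nf hae hbe hce)
    (h.kind_ne_bad hcd hce hde) (nk hac hcd hce)
    (h.hemiTable_four hbc hbd hbe hcd hce hde)] at h₅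
  exact Bool.false_ne_true h₅


section Iso

universe w

variable {W : Type v} {U : Type w} {H : Dgraph W} {K : Dgraph U}

theorem Iso.symm (h : Iso G H) : Iso H G := by
  obtain ⟨e, he⟩ := h
  exact ⟨e.symm, fun x y => by simp [he]⟩

theorem Iso.trans (h : Iso G H) (h' : Iso H K) : Iso G K := by
  obtain ⟨e, he⟩ := h
  obtain ⟨f, hf⟩ := h'
  exact ⟨e.trans f, fun x y => (he x y).trans (hf _ _)⟩

theorem Iso.dual (h : Iso G H) : Iso G.dual H.dual := by
  obtain ⟨e, he⟩ := h
  exact ⟨e, fun x y => he y x⟩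

theorem Iso.selfDual (h : Iso G H) (hG : SelfDual G) : SelfDual H :=
  (h.symm.trans hG).trans h.dual

theorem Hemi.selfDual (h : Hemi G H) (hH : SelfDual H) : SelfDual G := by
  rcases h with h | h
  · exact h.symm.selfDual hH
  · exact Iso.dual (h.symm.selfDual hH)

theorem iso_ind_image {f : V → W} {S : Set V} (hf : Set.InjOn f S)
    (h : ∀ x ∈ S, ∀ y ∈ S, G.Arc x y ↔ H.Arc (f x) (f y)) :
    Iso (G.ind S) (H.ind (f '' S)) :=
  ⟨Equiv.Set.imageOfInjOn f S hf, fun x y => h x x.2 y y.2⟩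

/-- An isomorphism between digraphs induced on the same set, as a map of the vertices. -/
theorem Iso.exists_map {H : Dgraph V} {Y : Set V} (h : Iso (G.ind Y) (H.ind Y)) :
    ∃ f : V → V, Function.Injective f ∧ f '' Y = Y ∧
      ∀ S ⊆ Y, Iso (G.ind S) (H.ind (f '' S)) := by
  classical
  obtain ⟨e, he⟩ := h
  have hval (x : Y) : Equiv.Perm.ofSubtype e x = e x := Equiv.Perm.ofSubtype_apply_coe e x
  have hmem {x : V} (hx : x ∈ Y) : Equiv.Perm.ofSubtype e x ∈ Y := by
    rw [hval ⟨x, hx⟩]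
    exact (e ⟨x, hx⟩).2
  refine ⟨Equiv.Perm.ofSubtype e, (Equiv.Perm.ofSubtype e).injective, ?_, fun S hS => ?_⟩
  · refine Set.Subset.antisymm (Set.image_subset_iff.2 fun x hx => hmem hx) fun x hx => ?_
    refine ⟨e.symm ⟨x, hx⟩, (e.symm ⟨x, hx⟩).2, ?_⟩
    rw [hval, Equiv.apply_symm_apply]
  · refine iso_ind_image (Equiv.injective _).injOn fun x hx y hy => ?_
    rw [hval ⟨x, hS hx⟩, hval ⟨y, hS hy⟩]
    exact he ⟨x, hS hx⟩ ⟨y, hS hy⟩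

theorem selfDual_ind_pair (x y : V) : SelfDual (G.ind {x, y}) := by
  classical
  have := iso_ind_image (G := G) (H := G.dual) (f := Equiv.swap x y) (S := {x, y})
    (Equiv.injective _).injOn (by
    rintro u (rfl | rfl) v (rfl | rfl) <;> simp [Dgraph.dual, G.irrefl])
  rwa [Set.image_pair, Equiv.swap_apply_left, Equiv.swap_apply_right, Set.pair_comm y x] at this

theorem three_le_ncard {S : Set V} (hfin : S.Finite) (hS : ¬ SelfDual (G.ind S)) :
    3 ≤ S.ncard := by
  by_contra! hlt
  apply hS
  obtain h | h | h : S.ncard = 0 ∨ S.ncard = 1 ∨ S.ncard = 2 := by omega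
  · obtain rfl := (Set.ncard_eq_zero hfin).1 h
    exact ⟨Equiv.refl _, fun x => x.2.elim⟩
  · obtain ⟨x, rfl⟩ := Set.ncard_eq_one.1 h
    have := selfDual_ind_pair (G := G) x x
    rwa [Set.pair_eq_singleton] at this
  · obtain ⟨x, y, -, rfl⟩ := Set.ncard_eq_two.1 h
    exact selfDual_ind_pair x y

theorem Cdual_le {S : Set V} (hfin : S.Finite) (hS : ¬ SelfDual (G.ind S)) :
    G.Cdual ≤ S.ncard :=
  sInf_le ⟨S, hfin, hS, rfl⟩

theorem exists_of_Cdual_eq_three (h : G.Cdual = 3) :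
    ∃ S : Set V, S.ncard = 3 ∧ ¬ SelfDual (G.ind S) := by
  have hmem : G.Cdual ∈ {n : ℕ∞ | ∃ X : Set V, X.Finite ∧ ¬ SelfDual (G.ind X) ∧
      n = (X.ncard : ℕ∞)} := by
    refine csInf_mem (Set.nonempty_iff_ne_empty.2 fun he => ?_)
    rw [Cdual, he, sInf_empty] at h
    exact absurd h (by decide)
  rw [h] at hmem
  obtain ⟨X, -, hX, hc⟩ := hmem
  exact ⟨X, by exact_mod_cast hc.symm, hX⟩

end Iso

theorem exists_triple_of_mem {S : Set V} (hS : S.ncard = 3) {a : V} (ha : a ∈ S) :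
    ∃ b c, a ≠ b ∧ a ≠ c ∧ b ≠ c ∧ S = {a, b, c} := by
  obtain ⟨x, y, z, hxy, hxz, hyz, rfl⟩ := Set.ncard_eq_three.1 hS
  rcases ha with rfl | rfl | rfl
  · exact ⟨y, z, hxy, hxz, hyz, rfl⟩
  · exact ⟨x, z, hxy.symm, hyz, hxz, Set.insert_comm _ _ _⟩
  · refine ⟨x, y, hxz.symm, hyz.symm, hxy, ?_⟩
    rw [Set.pair_comm, Set.insert_comm, Set.insert_comm _ x, Set.pair_comm _ y, Set.insert_comm x]

theorem LeHemi.disjoint_of_kept_flipped (h : LeHemi 6 G G') {T T' : Set V} (hT : T.ncard = 3)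
    (hT' : T'.ncard = 3) (hk : Kept G G' T) (hf : Flipped G G' T') : Disjoint T T' := by
  rw [Set.disjoint_left]
  intro a ha ha'
  obtain ⟨b, c, hab, hac, hbc, rfl⟩ := exists_triple_of_mem hT ha
  obtain ⟨d, e, had, hae, hde, rfl⟩ := exists_triple_of_mem hT' ha'
  have hk' : Kept G G' {a, c, b} := by rwa [Set.pair_comm c b]
  have hf' : Flipped G G' {a, e, d} := by rwa [Set.pair_comm e d]
  have two {b c e : V} (hab : a ≠ b) (hac : a ≠ c) (hae : a ≠ e) (hbc : b ≠ c) (hbe : b ≠ e)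
      (hk : Kept G G' {a, b, c}) (hf : Flipped G G' {a, b, e}) : False := by
    rcases eq_or_ne c e with rfl | hce
    · exact hf.2 hk.2
    · exact h.not_kept_flipped_of_two_common hab hac hae hbc hbe hce hk hf
  rcases eq_or_ne b d with rfl | hbd
  · exact two hab hac hae hbc hde hk hf
  rcases eq_or_ne b e with rfl | hbe
  · exact two hab hac had hbc hbd hk hf'
  rcases eq_or_ne c d with rfl | hcd
  · exact two hac hab hae hbc.symm hde hk' hf
  rcases eq_or_ne c e with rfl | hce
  · exact two hac hab had hbc.symm hcd hk' hf'
  exact h.not_kept_flipped_of_one_common hab hac had hae hbc hbd hbe hcd hce hde hk hf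

theorem LeHemi.not_kept_flipped (h : LeHemi 6 G G') {T T' : Set V} (hT : T.ncard = 3)
    (hT' : T'.ncard = 3) (hk : Kept G G' T) (hf : Flipped G G' T') : False := by
  have hdisj := h.disjoint_of_kept_flipped hT hT' hk hf
  have hfin : T.Finite := Set.finite_of_ncard_ne_zero (by omega)
  have hfin' : T'.Finite := Set.finite_of_ncard_ne_zero (by omega)
  have hTT' : T ≠ T' := by
    rintro rfl
    exact hf.2 hk.2
  have honly : ∀ S ⊆ T ∪ T', S.ncard = 3 → ¬ SelfDual (G.ind S) → S = T ∨ S = T' := by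
    intro S hS hc hsd
    by_cases hi : Iso (G.ind S) (G'.ind S)
    · have := h.disjoint_of_kept_flipped hc hT' ⟨hsd, hi⟩ hf
      exact .inl (Set.eq_of_subset_of_ncard_le (this.subset_left_of_subset_union hS)
        (by omega) hfin)
    · have := h.disjoint_of_kept_flipped hT hc hk ⟨hsd, hi⟩
      exact .inr (Set.eq_of_subset_of_ncard_le (this.symm.subset_right_of_subset_union hS)
        (by omega) hfin')
  have himage : ∀ {H : Dgraph V}, (∀ S, SelfDual (H.ind S) → SelfDual (G.ind S)) →
      Iso (H.ind (T ∪ T')) (G'.ind (T ∪ T')) →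
      (Iso (H.ind T) (G'.ind T) ∧ Iso (H.ind T') (G'.ind T')) ∨
      (Iso (H.ind T) (G'.ind T') ∧ Iso (H.ind T') (G'.ind T)) := by
    intro H hH hiso
    obtain ⟨f, hinj, himg, hf_iso⟩ := hiso.exists_map
    have hmem : ∀ S ⊆ T ∪ T', S.ncard = 3 → ¬ SelfDual (G.ind S) →
        f '' S = T ∨ f '' S = T' := by
      intro S hS hc hsd
      have hc' : (f '' S).ncard = 3 := by rw [Set.ncard_image_of_injective _ hinj, hc]
      refine honly _ ((Set.image_mono hS).trans himg.le) hc' fun H' => hsd (hH S ?_)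
      have := h 3 (by norm_num) (by norm_num) (f '' S)
        (Set.finite_of_ncard_ne_zero (by omega)) hc'
      refine (hf_iso S hS).symm.selfDual ?_
      rcases this with h₁ | h₁
      · exact h₁.selfDual H'
      · exact h₁.selfDual H'.dual
    have hi := hf_iso T Set.subset_union_left
    have hi' := hf_iso T' Set.subset_union_right
    have hne : f '' T ≠ f '' T' := fun H => hTT' (hinj.image_injective H)
    rcases hmem T Set.subset_union_left hT hk.1 with h₁ | h₁ <;>
      rcases hmem T' Set.subset_union_right hT' hf.1 with h₂ | h₂
    · exact (hne (h₁.trans h₂.symm)).elim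
    · rw [h₁] at hi
      rw [h₂] at hi'
      exact .inl ⟨hi, hi'⟩
    · rw [h₁] at hi
      rw [h₂] at hi'
      exact .inr ⟨hi, hi'⟩
    · exact (hne (h₁.trans h₂.symm)).elim
  have hcard : (T ∪ T').ncard = 6 := by rw [Set.ncard_union_eq hdisj hfin hfin', hT, hT']
  rcases h 6 (by norm_num) le_rfl _ (hfin.union hfin') hcard with hG | hG
  · rcases himage (fun _ => id) hG with ⟨-, h₁⟩ | ⟨h₁, h₂⟩
    · exact hf.2 h₁
    · exact hf.2 ((h₂.trans hk.2.symm).trans h₁)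
  · rcases himage (H := G.dual) (fun _ => Iso.dual) hG with ⟨h₁, -⟩ | ⟨h₁, h₂⟩
    · exact hk.1 (hk.2.trans h₁.symm)
    · have h₃ : Iso (G.ind T) (G.dual.ind T') := hk.2.trans h₂.symm
      have h₄ : Iso (G.dual.ind T') (G'.ind T') :=
        (h 3 (by norm_num) (by norm_num) T' hfin' hT').resolve_left hf.2
      exact hk.1 ((h₃.trans h₄).trans h₁.symm)

/-- If some smallest set that is not self-dual induces isomorphic digraphs, then no triple is
flipped. -/
theorem LeHemi.not_flipped (h : LeHemi 6 G G') {I : Set V} (hfin : I.Finite)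
    (hcard : (I.ncard : ℕ∞) = G.Cdual) (hnsd : ¬ SelfDual (G.ind I))
    (hiso : Iso (G.ind I) (G'.ind I)) {T : Set V} (hT : T.ncard = 3) : ¬ Flipped G G' T := by
  intro hf
  have hle : (I.ncard : ℕ∞) ≤ T.ncard :=
    hcard.trans_le (Cdual_le (Set.finite_of_ncard_ne_zero (by omega)) hf.1)
  have hI : I.ncard = 3 := le_antisymm (hT ▸ by exact_mod_cast hle) (three_le_ncard hfin hnsd)
  exact h.not_kept_flipped hI hT ⟨hnsd, hiso⟩ hf

theorem LeHemi.kind_ne_flipped (h : LeHemi 6 G G')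
    (hnf : ∀ T : Set V, T.ncard = 3 → ¬ Flipped G G' T) {x y z : V}
    (hxy : x ≠ y) (hxz : x ≠ z) (hyz : y ≠ z) : kind G G' x y z ≠ .flipped := by
  rw [Ne, h.kind_eq_flipped_iff hxy hxz hyz]
  exact hnf _ (Set.ncard_eq_three.2 ⟨x, y, z, hxy, hxz, hyz, rfl⟩)

theorem PairType.flip_swap {t : PairType} : t.swap.Flip ↔ t.Flip := by
  cases t <;> simp [PairType.Flip, PairType.swap]

theorem SamePairs.diffStep_symm (hp : SamePairs G G') {x y : V} (h : DiffStep G G' x y) :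
    DiffStep G G' y x := by
  rwa [← flip_pairType_iff hp, ← swap_pairType hp, PairType.flip_swap, flip_pairType_iff hp]

theorem DiffStep.ne {x y : V} (h : DiffStep G G' x y) : x ≠ y := by
  rintro rfl
  exact absurd h (by simp [DiffStep, G.irrefl, G'.irrefl])

theorem SamePairs.dir_of_diffStep (hp : SamePairs G G') {x y : V} (h : DiffStep G G' x y) :
    G.Dir x y :=
  dir_of_not_neutral_pairType (not_neutral_of_flip ((flip_pairType_iff hp).2 h))

theorem DiffRel.iff_reflTransGen {x y : V} :
    DiffRel G G' x y ↔ Relation.ReflTransGen (DiffStep G G') x y := by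
  rw [Relation.reflTransGen_iff_eq_or_transGen, DiffRel, eq_comm]

/-- A vertex outside a difference class sees all the vertices of the class in the same way. -/
theorem LeHemi.pairType_eq (h : LeHemi 6 G G')
    (hnf : ∀ T : Set V, T.ncard = 3 → ¬ Flipped G G' T) {c x y : V} (hx : ¬ DiffRel G G' c x)
    (hy : DiffRel G G' c y) : pairType G G' x y = pairType G G' x c := by
  have hp := h.samePairs (by norm_num)
  rw [DiffRel.iff_reflTransGen] at hx hy
  have hne {v : V} (hv : Relation.ReflTransGen (DiffStep G G') c v) : x ≠ v := by
    rintro rfl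
    exact hx hv
  have hnflip {v : V} (hv : Relation.ReflTransGen (DiffStep G G') c v) :
      ¬ (pairType G G' x v).Flip := by
    rw [flip_pairType_iff hp]
    exact fun H => hx (hv.tail (hp.diffStep_symm H))
  induction hy with
  | refl => rfl
  | @tail y z hy hyz ih =>
    have hz := hy.tail hyz
    rw [← ih]
    exact (eq_of_flip _ _ ((flip_pairType_iff hp).2 hyz) _ (hnflip hy) (hnflip hz)
      (h.kind_ne_bad (hne hy) (hne hz) hyz.ne)
      (h.kind_ne_flipped hnf (hne hy) (hne hz) hyz.ne)).symm

theorem LeHemi.isInterval (h : LeHemi 6 G G')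
    (hnf : ∀ T : Set V, T.ncard = 3 → ¬ Flipped G G' T) {C : Set V} (hC : DiffClass G G' C) :
    G.IsInterval C ∧ G'.IsInterval C := by
  have hp := h.samePairs (by norm_num)
  obtain ⟨c, rfl⟩ := hC
  have harc : ∀ x ∉ {y | DiffRel G G' c y}, ∀ y ∈ {y | DiffRel G G' c y},
      ((G.Arc x y ↔ G.Arc x c) ∧ (G.Arc y x ↔ G.Arc c x)) ∧
      ((G'.Arc x y ↔ G.Arc x c) ∧ (G'.Arc y x ↔ G.Arc c x)) := by
    intro x hx y hy
    have heq := congrArg PairType.fst (h.pairType_eq hnf hx hy)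
    rw [fst_pairType, fst_pairType, pairType_eq_iff] at heq
    have hyx : ¬ DiffStep G G' y x := fun H =>
      hx (DiffRel.iff_reflTransGen.2 ((DiffRel.iff_reflTransGen.1 hy).tail H))
    have hxy : ¬ DiffStep G G' x y := fun H => hyx (hp.diffStep_symm H)
    unfold DiffStep at hxy hyx
    tauto
  constructor <;> intro x hx <;> have := harc x hx <;> by_cases h₁ : G.Arc x c <;>
    by_cases h₂ : G.Arc c x <;> simp_all

theorem diffRel_of_not_atLeastTwo (h : ¬ AtLeastTwoDiffClasses G G') (x y : V) :
    DiffRel G G' x y := by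
  by_contra hxy
  refine h ⟨_, _, ⟨x, rfl⟩, ⟨y, rfl⟩, fun H => hxy ?_⟩
  have : y ∈ {z | DiffRel G G' x z} := H ▸ Or.inl rfl
  exact this

theorem reflTransGen_of_ind {D : Set V} {x y : D} (h : DiffRel (G.ind D) (G'.ind D) x y) :
    Relation.ReflTransGen (DiffStep G G') x y :=
  (DiffRel.iff_reflTransGen.1 h).lift Subtype.val fun _ _ => id

theorem LeHemi.isInterval_of_component (h : LeHemi 6 G G')
    (hnf : ∀ T : Set V, T.ncard = 3 → ¬ Flipped G G' T) {D : Set V} (hD : G.IsACComponent D)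
    (hone : ∀ x y : D, DiffRel (G.ind D) (G'.ind D) x y) : G.IsInterval D := by
  have hp := h.samePairs (by norm_num)
  refine (h.isInterval hnf ?_).1
  obtain ⟨x, hx⟩ := hD
  have hxD : x ∈ D := hx ▸ Relation.ReflTransGen.refl
  refine ⟨x, Set.Subset.antisymm (fun y hy => ?_) fun y hy => ?_⟩
  · exact DiffRel.iff_reflTransGen.2 (reflTransGen_of_ind (hone ⟨x, hxD⟩ ⟨y, hy⟩))
  · rw [hx]
    exact Relation.ReflTransGen.mono (fun _ _ => hp.dir_of_diffStep) _ _
      (DiffRel.iff_reflTransGen.1 hy)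

theorem neutral_pairType_comm (hp : SamePairs G G') {x y : V} :
    (pairType G G' y x).Neutral ↔ (pairType G G' x y).Neutral := by
  rw [← swap_pairType hp]
  cases pairType G G' x y <;> simp [PairType.Neutral, PairType.swap]

theorem LeHemi.exists_neutral_directed (h : LeHemi 6 G G') {T : Set V} (hT : T.ncard = 3)
    (hk : Kept G G' T) : ∃ m p q, m ≠ p ∧ m ≠ q ∧ p ≠ q ∧ T = {m, p, q} ∧
      (pairType G G' p q).Neutral ∧ ¬ (pairType G G' m q).Neutral := by
  have hp := h.samePairs (by norm_num)
  obtain ⟨x, y, z, hxy, hxz, hyz, rfl⟩ := Set.ncard_eq_three.1 hT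
  have := exists_neutral_directed_of_kept _ _ _ ((h.kind_eq_kept_iff hxy hxz hyz).2 hk)
  rw [swap_pairType hp] at this
  rcases this with ⟨h₁, h₂⟩ | ⟨h₁, h₂⟩ | ⟨h₁, h₂⟩ | ⟨h₁, h₂⟩ | ⟨h₁, h₂⟩ | ⟨h₁, h₂⟩
  · exact ⟨x, z, y, hxz, hxy, hyz.symm, by grind, (neutral_pairType_comm hp).2 h₁, h₂⟩
  · exact ⟨x, y, z, hxy, hxz, hyz, by grind, h₁, mt (neutral_pairType_comm hp).2 h₂⟩
  · exact ⟨y, x, z, hxy.symm, hyz, hxz, by grind, (neutral_pairType_comm hp).2 h₁, h₂⟩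
  · exact ⟨y, z, x, hyz, hxy.symm, hxz.symm, by grind, h₁, mt (neutral_pairType_comm hp).2 h₂⟩
  · exact ⟨z, y, x, hyz.symm, hxz.symm, hxy.symm, by grind,
      (neutral_pairType_comm hp).2 h₁, h₂⟩
  · exact ⟨z, x, y, hxz.symm, hyz.symm, hxy, by grind, h₁, mt (neutral_pairType_comm hp).2 h₂⟩

/-- A kept triple is not contained in a difference class. -/
theorem LeHemi.exists_not_diffRel (h : LeHemi 6 G G')
    (hnf : ∀ T : Set V, T.ncard = 3 → ¬ Flipped G G' T) {T : Set V} (hT : T.ncard = 3)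
    (hk : Kept G G' T) : ∃ m ∈ T, ∃ q ∈ T, ¬ DiffRel G G' m q := by
  have hp := h.samePairs (by norm_num)
  obtain ⟨m, p, q, hmp, hmq, hpq, rfl, hneu, hdir⟩ := h.exists_neutral_directed hT hk
  refine ⟨m, by simp, q, by simp, fun hrel => hdir ?_⟩
  have hkind := (h.kind_eq_kept_iff hmp hmq hpq).2 hk
  obtain ⟨hfmp, hfmq⟩ := not_flip_of_kept _ _ _ hkind hneu hdir
  have key : ∀ v, Relation.ReflTransGen (DiffStep G G') m v →
      pairType G G' v p = pairType G G' m p ∧ pairType G G' v q = pairType G G' m q := by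
    intro v hv
    induction hv with
    | refl => exact ⟨rfl, rfl⟩
    | @tail v e _ hve ih =>
      obtain ⟨ihp, ihq⟩ := ih
      have hvp : v ≠ p := by
        rintro rfl
        exact hdir (ihq ▸ hneu)
      have hvq : v ≠ q := by
        rintro rfl
        exact hdir (ihq ▸ by simp [PairType.Neutral])
      have hep : e ≠ p := by
        rintro rfl
        exact hfmp (ihp ▸ (flip_pairType_iff hp).2 hve)
      have heq : e ≠ q := by
        rintro rfl
        exact hfmq (ihq ▸ (flip_pairType_iff hp).2 hve)
      have hev := hp.diffStep_symm hve
      have hkind' : kind G G' v p q = .kept := by rwa [kind, ihp, ihq]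
      rw [← ihp, ← ihq]
      exact eq_and_eq_of_flip _ _ _ hkind' hneu (ihq ▸ hdir) _ ((flip_pairType_iff hp).2 hev)
        _ (h.kind_ne_bad hev.ne hep hvp) (h.kind_ne_flipped hnf hev.ne hep hvp)
        _ (h.kind_ne_bad hev.ne heq hvq) (h.kind_ne_flipped hnf hev.ne heq hvq)
        (h.kind_ne_bad hep heq hpq) (h.kind_ne_flipped hnf hep heq hpq)
        (h.hemiTable_four hev.ne hep heq hvp hvq hpq)
  rw [← (key q (DiffRel.iff_reflTransGen.1 hrel)).2]
  simp [PairType.Neutral]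

theorem exists_subset_of_Cdual_ind_eq_three {D : Set V} (h : Cdual (G.ind D) = 3) :
    ∃ T ⊆ D, T.ncard = 3 ∧ ¬ SelfDual (G.ind T) := by
  obtain ⟨X, hX, hnsd⟩ := exists_of_Cdual_eq_three h
  refine ⟨Subtype.val '' X, Subtype.coe_image_subset D X, ?_, fun H => hnsd ?_⟩
  · rw [Set.ncard_image_of_injective _ Subtype.val_injective, hX]
  · exact (iso_ind_image (G := G.ind D) (H := G) Subtype.val_injective.injOn
      fun _ _ _ _ => Iff.rfl).symm.selfDual H

end Dgraph

open Dgraph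
/-- Corollary cy. -/
theorem corollary_cy {V : Type u} (G G' : Dgraph V)
    (hhemi : Dgraph.LeHemi 6 G G') (D : Set V) (hD : G.IsACComponent D)
    (I₀ : Set V) (hfin : I₀.Finite) (hcard : (I₀.ncard : ℕ∞) = G.Cdual)
    (hnsd : ¬ Dgraph.SelfDual (G.ind I₀))
    (hiso : Dgraph.Iso (G'.ind I₀) (G.ind I₀)) :
    (∀ C : Set V, Dgraph.DiffClass G G' C → G.IsInterval C ∧ G'.IsInterval C) ∧
    (¬ G.IsInterval D → Dgraph.AtLeastTwoDiffClasses (G.ind D) (G'.ind D)) ∧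
    (Dgraph.Cdual (G.ind D) = 3 → Dgraph.AtLeastTwoDiffClasses (G.ind D) (G'.ind D)) := by
  have hnf : ∀ T : Set V, T.ncard = 3 → ¬ Flipped G G' T := fun _ =>
    hhemi.not_flipped hfin hcard hnsd hiso.symm
  refine ⟨fun C => hhemi.isInterval hnf, fun hnint => ?_, fun hthree => ?_⟩ <;> by_contra hone
  · exact hnint (hhemi.isInterval_of_component hnf hD (diffRel_of_not_atLeastTwo hone))
  · obtain ⟨T, hTD, hT, hsd⟩ := exists_subset_of_Cdual_ind_eq_three hthree
    obtain ⟨m, hm, q, hq, hmq⟩ := hhemi.exists_not_diffRel hnf hT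
      ⟨hsd, by_contra fun H => hnf T hT ⟨hsd, H⟩⟩
    exact hmq (DiffRel.iff_reflTransGen.2 (reflTransGen_of_ind
      (diffRel_of_not_atLeastTwo hone ⟨m, hTD hm⟩ ⟨q, hTD hq⟩)))
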